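/- arXiv:2303.08619 — 3 statements merged into one kernel-verified Lean document; each statement's English description precedes it below -/
import Mathlib

section
/- Let m ≥ 1 and h(x_1,…,x_m) = x_1 + ⋯ + x_m. There exists N ∈ ℕ with N > max(2,m) such that, for X_1,…,X_N i.i.d. with P(X_i = p^{1/2}(1−p)^{−1/2}) = 1 − p and P(X_i = −(1−p)^{1/2}p^{−1/2}) = p where p = 1/N, the Studentized U-statistic T_N built from this kernel satisfies liminf_{x→∞} |P(T_N ≤ x) − Φ(x)| ≥ e^{−1}/2. In particular, no bound of the form |P(T_N ≤ x) − Φ(x)| ≤ C(m,N,x,law of X_1,h) with C(m,N,x,·,·) → 0 as x → ∞ (other parameters fixed) can hold. -/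
open MeasureTheory ProbabilityTheory Filter

noncomputable section

/-- The standard normal cumulative distribution function `Φ`. -/
def stdNormalCDF (x : ℝ) : ℝ := ((gaussianReal 0 1) (Set.Iic x)).toReal

/-- The values of `x` on an `m`-element subset `s` of indices, in increasing order. -/
def subTuple {𝓧 : Type*} {n m : ℕ} (x : Fin n → 𝓧) (s : Finset (Fin n)) (hs : s.card = m) :
    Fin m → 𝓧 := fun j => x ((s.orderIsoOfFin hs j : Fin n))

/-- `∑_{1 ≤ i₁ < ⋯ < i_m ≤ n} k (x_{i₁}, …, x_{i_m})` for a symmetric kernel `k`. -/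
def sumKernel {𝓧 : Type*} (m n : ℕ) (k : (Fin m → 𝓧) → ℝ) (x : Fin n → 𝓧) : ℝ :=
  ∑ s ∈ (Finset.powersetCard m (Finset.univ : Finset (Fin n))).attach,
    k (subTuple x s.1 (Finset.mem_powersetCard.mp s.2).2)

/-- The U-statistic of degree `m` with kernel `k`. -/
def UStat {𝓧 : Type*} (m n : ℕ) (k : (Fin m → 𝓧) → ℝ) (x : Fin n → 𝓧) : ℝ :=
  (n.choose m : ℝ)⁻¹ * sumKernel m n k x

/-- `q i`: average of the kernel over all `m`-subsets containing `i`
(for a symmetric kernel this is the average over `h (x i, x_{i₁}, …, x_{i_{m-1}})`,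
`i_l ≠ i`). -/
def qStat {𝓧 : Type*} (m n : ℕ) (k : (Fin m → 𝓧) → ℝ) (x : Fin n → 𝓧) (i : Fin n) : ℝ :=
  ((n - 1).choose (m - 1) : ℝ)⁻¹ *
    ∑ s ∈ ((Finset.powersetCard m (Finset.univ : Finset (Fin n))).filter fun s => i ∈ s).attach,
      k (subTuple x s.1 (Finset.mem_powersetCard.mp (Finset.mem_filter.mp s.2).1).2)

/-- The jackknife variance estimator `σ̂²`. -/
def jackknifeVar {𝓧 : Type*} (m n : ℕ) (k : (Fin m → 𝓧) → ℝ) (x : Fin n → 𝓧) : ℝ :=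
  ((n : ℝ) - 1) / ((n : ℝ) - m) ^ 2 *
    (∑ i : Fin n, (qStat m n k x i) ^ 2 - n * (UStat m n k x) ^ 2)

/-- The Studentized U-statistic `T_n = √n U_n / (m σ̂)`, with the convention that it is
`+∞` (resp. `-∞`, `0`) when `σ̂ = 0` and `U_n > 0` (resp. `U_n < 0`, `U_n = 0`). -/
def TStat {𝓧 : Type*} (m n : ℕ) (k : (Fin m → 𝓧) → ℝ) (x : Fin n → 𝓧) : EReal :=
  if Real.sqrt (jackknifeVar m n k x) = 0 then
    (if 0 < UStat m n k x then (⊤ : EReal)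
      else if UStat m n k x < 0 then (⊥ : EReal) else (0 : EReal))
  else
    (((Real.sqrt n * UStat m n k x) / (m * Real.sqrt (jackknifeVar m n k x)) : ℝ) : EReal)

/-- First-order canonical (conditional-expectation) function
`g a = E[h(X₁,…,X_m) ∣ X₁ = a]`, when the `Xᵢ` have common law `μ`. -/
def condG {𝓧 : Type*} [MeasurableSpace 𝓧] (m : ℕ) (hm : 0 < m) (h : (Fin m → 𝓧) → ℝ)
    (μ : Measure 𝓧) (a : 𝓧) : ℝ :=
  ∫ y, h (Function.update y ⟨0, hm⟩ a) ∂(Measure.pi fun _ : Fin m => μ)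

end

noncomputable section

/-- Novak's two-point distribution: mass `1 − p` at `√(p/(1−p))` and mass `p` at
`−√((1−p)/p)`. -/
def novakMeasure (p : ℝ) : Measure ℝ :=
  ENNReal.ofReal (1 - p) • Measure.dirac (Real.sqrt (p / (1 - p))) +
    ENNReal.ofReal p • Measure.dirac (-Real.sqrt ((1 - p) / p))

/-- In an `n`-element index set, each index lies in `(n - 1).choose (m - 1)` of the subsets
of size `m`. -/
lemma card_filter_mem_powersetCard_univ {n m : ℕ} (hm : 1 ≤ m) (i : Fin n) :
    ((Finset.powersetCard m (Finset.univ : Finset (Fin n))).filter fun s => i ∈ s).card =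
      (n - 1).choose (m - 1) := by
  simpa using Finset.card_filter_powersetCard_subset {i} (Finset.univ : Finset (Fin n)) m
    (Finset.subset_univ _) (by simpa using hm)

lemma UStat_sum_const {m n : ℕ} (hmn : m ≤ n) (a : ℝ) :
    UStat m n (fun v => ∑ j, v j) (fun _ => a) = m * a := by
  have h : (n.choose m : ℝ) ≠ 0 := by exact_mod_cast (Nat.choose_pos hmn).ne'
  simp only [UStat, sumKernel, subTuple, Finset.sum_const, Finset.card_attach,
    Finset.card_powersetCard, Finset.card_univ, Fintype.card_fin, nsmul_eq_mul]
  field_simp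

lemma qStat_sum_const {m n : ℕ} (hm : 1 ≤ m) (hmn : m ≤ n) (a : ℝ) (i : Fin n) :
    qStat m n (fun v => ∑ j, v j) (fun _ => a) i = m * a := by
  have h : ((n - 1).choose (m - 1) : ℝ) ≠ 0 := by
    exact_mod_cast (Nat.choose_pos (Nat.sub_le_sub_right hmn 1)).ne'
  simp only [qStat, subTuple, Finset.sum_const, Finset.card_attach,
    card_filter_mem_powersetCard_univ hm, Finset.card_univ, Fintype.card_fin, nsmul_eq_mul]
  field_simp

lemma TStat_sum_const {m n : ℕ} (hm : 1 ≤ m) (hmn : m ≤ n) {a : ℝ} (ha : 0 < a) :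
    TStat m n (fun v => ∑ j, v j) (fun _ => a) = ⊤ := by
  have hvar : jackknifeVar m n (fun v => ∑ j, v j) (fun _ => a) = 0 := by
    simp [jackknifeVar, UStat_sum_const hmn, qStat_sum_const hm hmn]
  have hU : 0 < (m : ℝ) * a := mul_pos (by exact_mod_cast hm) ha
  simp [TStat, hvar, UStat_sum_const hmn, hU]

lemma isProbabilityMeasure_novakMeasure {p : ℝ} (h0 : 0 ≤ p) (h1 : p ≤ 1) :
    IsProbabilityMeasure (novakMeasure p) := by
  constructor
  simp [novakMeasure, ← ENNReal.ofReal_add (sub_nonneg.mpr h1) h0]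

lemma ofReal_le_novakMeasure_singleton (p : ℝ) :
    ENNReal.ofReal (1 - p) ≤ novakMeasure p {Real.sqrt (p / (1 - p))} := by
  simp [novakMeasure]

/-- If all observations agree and are positive then `T_n = +∞`, so `T_n` is finite with
probability at most `1 - (1 - p) ^ n`. -/
lemma measure_TStat_le {m n : ℕ} (hm : 1 ≤ m) (hmn : m ≤ n) {p : ℝ} (h0 : 0 < p) (h1 : p < 1)
    (x : ℝ) :
    ((Measure.pi fun _ : Fin n => novakMeasure p)
      {y | TStat m n (fun v => ∑ j, v j) y ≤ (x : EReal)}).toReal ≤ 1 - (1 - p) ^ n := by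
  have := isProbabilityMeasure_novakMeasure h0.le h1.le
  set P := Measure.pi fun _ : Fin n => novakMeasure p
  set a := Real.sqrt (p / (1 - p))
  have ha : 0 < a := Real.sqrt_pos.mpr (div_pos h0 (sub_pos.mpr h1))
  set A : Set (Fin n → ℝ) := Set.univ.pi fun _ => {a}
  have hA : MeasurableSet A := MeasurableSet.univ_pi fun _ => measurableSet_singleton a
  have hsub : {y | TStat m n (fun v => ∑ j, v j) y ≤ (x : EReal)} ⊆ Aᶜ := by
    intro y hy hyA
    obtain rfl : y = fun _ => a := funext fun i => hyA i (Set.mem_univ i)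
    rw [Set.mem_ofPred_eq, TStat_sum_const hm hmn ha] at hy
    exact EReal.coe_ne_top x (top_le_iff.mp hy)
  have hPA : (1 - p) ^ n ≤ P.real A := by
    have h : ENNReal.ofReal (1 - p) ^ n ≤ P A := by
      rw [Measure.pi_pi, Finset.prod_const, Finset.card_univ, Fintype.card_fin]
      gcongr
      exact ofReal_le_novakMeasure_singleton p
    rw [← ENNReal.ofReal_pow (sub_pos.mpr h1).le] at h
    exact (ENNReal.ofReal_le_iff_le_toReal (measure_ne_top P A)).mp h
  calc (P {y | TStat m n (fun v => ∑ j, v j) y ≤ (x : EReal)}).toReal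
      ≤ P.real Aᶜ := measureReal_mono hsub
    _ = 1 - P.real A := probReal_compl_eq_one_sub hA
    _ ≤ 1 - (1 - p) ^ n := by linarith

lemma tendsto_stdNormalCDF_atTop : Tendsto stdNormalCDF atTop (nhds 1) := by
  have h := tendsto_measure_Iic_atTop (gaussianReal 0 1)
  rw [measure_univ] at h
  exact (ENNReal.tendsto_toReal ENNReal.one_ne_top).comp h

lemma eventually_exp_neg_one_div_two_lt :
    ∀ᶠ n : ℕ in atTop, Real.exp (-1) / 2 < (1 - 1 / (n : ℝ)) ^ n := by
  have h := Real.tendsto_one_add_div_pow_exp (-1)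
  filter_upwards [h.eventually_const_lt (half_lt_self (Real.exp_pos (-1)))] with n hn
  rwa [neg_div, ← sub_eq_add_neg] at hn

/-- **Impossibility of a vanishing-in-`x` nonuniform bound for Studentized
U-statistics.**  Let `m ≥ 1` and `h(x₁,…,x_m) = x₁ + ⋯ + x_m`.  There is an `N ∈ ℕ`
with `N > max(2,m)` such that for `X₁, …, X_N` i.i.d. with Novak's two-point law with
parameter `p = 1/N` (joint law the `N`-fold product), the Studentized U-statistic `T_N`
built from this kernel satisfies
`liminf_{x→∞} |P(T_N ≤ x) − Φ(x)| ≥ e^{−1}/2`;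
in particular, no bound `|P(T_N ≤ x) − Φ(x)| ≤ d(x)` with `d(x) → 0` as `x → ∞` can
hold. -/
theorem novak_studentized_U_stat_liminf (m : ℕ) (hm : 1 ≤ m) :
    ∃ N : ℕ, max 2 m < N ∧
      (Real.exp (-1) / 2 ≤
        Filter.liminf (fun x : ℝ =>
          |((Measure.pi fun _ : Fin N => novakMeasure (1 / (N : ℝ)))
              {y | TStat m N (fun v => ∑ j, v j) y ≤ (x : EReal)}).toReal -
            stdNormalCDF x|) Filter.atTop) ∧
      (∀ d : ℝ → ℝ, Filter.Tendsto d Filter.atTop (nhds 0) →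
        ¬ ∀ x : ℝ,
            |((Measure.pi fun _ : Fin N => novakMeasure (1 / (N : ℝ)))
                {y | TStat m N (fun v => ∑ j, v j) y ≤ (x : EReal)}).toReal -
              stdNormalCDF x| ≤ d x) := by
  obtain ⟨N, hexp, hN⟩ :=
    (eventually_exp_neg_one_div_two_lt.and (eventually_gt_atTop (max 2 m))).exists
  have hN2 : (2 : ℝ) < N := by exact_mod_cast (le_max_left 2 m).trans_lt hN
  have hmN : m ≤ N := ((le_max_right 2 m).trans_lt hN).le
  have hp0 : 0 < 1 / (N : ℝ) := by positivity
  have hp1 : 1 / (N : ℝ) < 1 := by rw [div_lt_one] <;> linarith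
  have := isProbabilityMeasure_novakMeasure hp0.le hp1.le
  have hev : ∀ᶠ x : ℝ in atTop, Real.exp (-1) / 2 ≤
      |((Measure.pi fun _ : Fin N => novakMeasure (1 / (N : ℝ)))
          {y | TStat m N (fun v => ∑ j, v j) y ≤ (x : EReal)}).toReal - stdNormalCDF x| := by
    have hlt : 1 - ((1 - 1 / (N : ℝ)) ^ N - Real.exp (-1) / 2) < 1 := by linarith
    filter_upwards [tendsto_stdNormalCDF_atTop.eventually_const_lt hlt] with x hx
    have hle := measure_TStat_le hm hmN hp0 hp1 x
    rw [abs_sub_comm]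
    exact le_trans (by linarith) (le_abs_self _)
  refine ⟨N, hN, le_liminf_of_le ?_ hev, fun d hd hbound => ?_⟩
  · refine (isBoundedUnder_of ⟨1, fun x => ?_⟩).isCoboundedUnder_ge
    refine abs_sub_le_iff.mpr ⟨?_, ?_⟩
    · exact (sub_le_self _ ENNReal.toReal_nonneg).trans measureReal_le_one
    · exact (sub_le_self _ ENNReal.toReal_nonneg).trans measureReal_le_one
  · have hpos : 0 < Real.exp (-1) / 2 := by positivity
    obtain ⟨x, hx, hdx⟩ := (hev.and (hd.eventually_lt_const hpos)).exists
    exact absurd (hx.trans (hbound x)) hdx.not_ge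

end
end

section
/- For x ≥ 1: f_x(w) ≤ 1.7·e^{−x} for w ≤ x−1, f_x(w) ≤ 1/x for x−1 < w ≤ x, and f_x(w) ≤ 1/w for w > x; |f_x′(w)| ≤ e^{1/2−x} for w ≤ x−1, |f_x′(w)| ≤ 1 for x−1 < w ≤ x, and |f_x′(w)| ≤ (1+x²)^{−1} for w > x; g_x(w) ≥ 0 for all w, g_x(w) ≤ 1.6·Φ̄(x) for w ≤ 0, g_x(w) ≤ 1/w for w > x; g_x is increasing on [0,x] with g_x(x−1) ≤ x·e^{1/2−x} and g_x(x) ≤ x+2. -/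
open MeasureTheory ProbabilityTheory

noncomputable section

/-- The bounded solution `f_x` of the Stein equation
`f′(w) − w f(w) = I(w ≤ x) − Φ(x)`:
`f_x(w) = √(2π) e^{w²/2} Φ(w) (1 − Φ(x))` for `w ≤ x` and
`f_x(w) = √(2π) e^{w²/2} Φ(x) (1 − Φ(w))` for `w > x`. -/
def steinF (x w : ℝ) : ℝ :=
  if w ≤ x then
    Real.sqrt (2 * Real.pi) * Real.exp (w ^ 2 / 2) * stdNormalCDF w * (1 - stdNormalCDF x)
  else
    Real.sqrt (2 * Real.pi) * Real.exp (w ^ 2 / 2) * stdNormalCDF x * (1 - stdNormalCDF w)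

/-- The derivative `f_x′` of the Stein solution (with the convention
`f_x′(x) = x f_x(x) + 1 − Φ(x)`, i.e. the left branch at `w = x`):
`f_x′(w) = (√(2π) w e^{w²/2} Φ(w) + 1)(1 − Φ(x))` for `w ≤ x` and
`f_x′(w) = (√(2π) w e^{w²/2} (1 − Φ(w)) − 1) Φ(x)` for `w > x`. -/
def steinF' (x w : ℝ) : ℝ :=
  if w ≤ x then
    (Real.sqrt (2 * Real.pi) * w * Real.exp (w ^ 2 / 2) * stdNormalCDF w + 1) *
      (1 - stdNormalCDF x)
  else
    (Real.sqrt (2 * Real.pi) * w * Real.exp (w ^ 2 / 2) * (1 - stdNormalCDF w) - 1) *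
      stdNormalCDF x

/-- `g_x(w) = (w f_x(w))′ = f_x(w) + w f_x′(w)`. -/
def steinG (x w : ℝ) : ℝ := steinF x w + w * steinF' x w

open Filter Topology in
lemma stdNormalCDF_tendsto_atTop : Tendsto stdNormalCDF atTop (𝓝 1) := by
  have h := tendsto_cdf_atTop (gaussianReal 0 1)
  have e : stdNormalCDF = fun x => cdf (gaussianReal 0 1) x := by
    funext x
    rw [cdf_eq_real]
    rfl
  rw [e]
  exact h

lemma stdNormalCDF_nonneg (x : ℝ) : 0 ≤ stdNormalCDF x := ENNReal.toReal_nonneg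

lemma stdNormalCDF_le_one (x : ℝ) : stdNormalCDF x ≤ 1 :=
  measureReal_le_one (μ := gaussianReal 0 1) (s := Set.Iic x)

lemma stdNormalCDF_mono : Monotone stdNormalCDF := fun _ _ h =>
  measureReal_mono (μ := gaussianReal 0 1) (Set.Iic_subset_Iic.2 h)

lemma stdNormalCDF_neg (x : ℝ) : stdNormalCDF (-x) = 1 - stdNormalCDF x := by
  have h1 : (gaussianReal 0 1) (Set.Iic (-x)) = (gaussianReal 0 1) (Set.Ici x) := by
    conv_lhs => rw [← neg_zero (G := ℝ), ← gaussianReal_map_neg]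
    rw [Measure.map_apply (by fun_prop) measurableSet_Iic]
    congr 1
    ext y
    simp
  have : NullSingletonClass (gaussianReal 0 1) := nullSingletonClass_gaussianReal one_ne_zero
  have h2 : (gaussianReal 0 1) (Set.Ici x) = (gaussianReal 0 1) (Set.Iic x)ᶜ := by
    rw [Set.compl_Iic, measure_congr Ioi_ae_eq_Ici]
  have h3 := probReal_compl_eq_one_sub (μ := gaussianReal 0 1) (measurableSet_Iic (a := x))
  unfold stdNormalCDF
  rw [h1, h2]
  exact h3

lemma stdNormalCDF_zero : stdNormalCDF 0 = 1 / 2 := by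
  have := stdNormalCDF_neg 0
  rw [neg_zero] at this
  linarith

lemma stdNormalCDF_hasDerivAt (x : ℝ) :
    HasDerivAt stdNormalCDF ((Real.sqrt (2 * Real.pi))⁻¹ * Real.exp (-(x ^ 2 / 2))) x := by
  have hint := integrable_gaussianPDFReal 0 1
  have hcont : Continuous (gaussianPDFReal 0 1) := by
    rw [gaussianPDFReal_def]
    fun_prop
  have e : stdNormalCDF =
      fun y => stdNormalCDF 0 + ∫ u in (0 : ℝ)..y, gaussianPDFReal 0 1 u := by
    have key : ∀ y, stdNormalCDF y = ∫ u in Set.Iic y, gaussianPDFReal 0 1 u := by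
      intro y
      unfold stdNormalCDF
      rw [gaussianReal_apply_eq_integral _ one_ne_zero, ENNReal.toReal_ofReal]
      exact integral_nonneg (gaussianPDFReal_nonneg _ _)
    funext y
    rw [key, key, ← intervalIntegral.integral_Iic_sub_Iic hint.integrableOn hint.integrableOn]
    ring
  have hd := (hcont.integral_hasStrictDerivAt 0 x).hasDerivAt.const_add (stdNormalCDF 0)
  rw [← e] at hd
  refine hd.congr_deriv ?_
  rw [gaussianPDFReal_def]
  simp [neg_div]

/-- The Mills ratio `(1 - Φ t) / φ t` of the standard normal law. -/
def millsRatio (t : ℝ) : ℝ :=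
  Real.sqrt (2 * Real.pi) * Real.exp (t ^ 2 / 2) * (1 - stdNormalCDF t)

lemma sqrt_two_pi_pos : 0 < Real.sqrt (2 * Real.pi) := by positivity

lemma millsRatio_nonneg (t : ℝ) : 0 ≤ millsRatio t := by
  have := stdNormalCDF_le_one t
  exact mul_nonneg (by positivity) (by linarith)

lemma millsRatio_neg (w : ℝ) :
    millsRatio (-w) = Real.sqrt (2 * Real.pi) * Real.exp (w ^ 2 / 2) * stdNormalCDF w := by
  unfold millsRatio
  rw [stdNormalCDF_neg]
  ring_nf

lemma hasDerivAt_exp_half_sq (t : ℝ) :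
    HasDerivAt (fun t : ℝ => Real.exp (t ^ 2 / 2)) (t * Real.exp (t ^ 2 / 2)) t := by
  have h2 : HasDerivAt (fun t : ℝ => t ^ 2 / 2) t t :=
    ((hasDerivAt_pow 2 t).div_const 2).congr_deriv (by simp)
  exact h2.exp.congr_deriv (mul_comm _ _)

lemma hasDerivAt_exp_neg_half_sq (t : ℝ) :
    HasDerivAt (fun t : ℝ => Real.exp (-(t ^ 2 / 2))) (-t * Real.exp (-(t ^ 2 / 2))) t := by
  have h2 : HasDerivAt (fun t : ℝ => -(t ^ 2 / 2)) (-t) t :=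
    ((hasDerivAt_pow 2 t).div_const 2).fun_neg.congr_deriv (by simp)
  exact h2.exp.congr_deriv (mul_comm _ _)

lemma hasDerivAt_normal_tail (t : ℝ) :
    HasDerivAt (fun t => Real.sqrt (2 * Real.pi) * (1 - stdNormalCDF t))
      (-Real.exp (-(t ^ 2 / 2))) t := by
  have := ((stdNormalCDF_hasDerivAt t).const_sub 1).const_mul (Real.sqrt (2 * Real.pi))
  refine this.congr_deriv ?_
  rw [mul_neg, mul_inv_cancel_left₀ sqrt_two_pi_pos.ne']

lemma millsRatio_hasDerivAt (t : ℝ) :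
    HasDerivAt millsRatio (t * millsRatio t - 1) t := by
  have h := (hasDerivAt_exp_half_sq t).mul (hasDerivAt_normal_tail t)
  have e : Real.exp (t ^ 2 / 2) * Real.exp (-(t ^ 2 / 2)) = 1 := by
    rw [← Real.exp_add]
    simp
  have hf : millsRatio = (fun t : ℝ => Real.exp (t ^ 2 / 2)) *
      fun t => Real.sqrt (2 * Real.pi) * (1 - stdNormalCDF t) := by
    funext u
    simp only [millsRatio, Pi.mul_apply]
    ring
  rw [hf]
  refine h.congr_deriv ?_
  simp only [Pi.mul_apply]
  linear_combination -e

open Filter Topology in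
lemma tendsto_normal_tail :
    Tendsto (fun t => Real.sqrt (2 * Real.pi) * (1 - stdNormalCDF t)) atTop (𝓝 0) := by
  have := (stdNormalCDF_tendsto_atTop.const_sub 1).const_mul (Real.sqrt (2 * Real.pi))
  simpa using this

open Filter Topology in
lemma tendsto_exp_neg_half_sq :
    Tendsto (fun t : ℝ => Real.exp (-(t ^ 2 / 2))) atTop (𝓝 0) := by
  refine Real.tendsto_exp_neg_atTop_nhds_zero.comp ?_
  exact (tendsto_pow_atTop two_ne_zero).atTop_div_const two_pos

lemma millsRatio_eq (t : ℝ) : millsRatio t =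
    Real.exp (t ^ 2 / 2) * (Real.sqrt (2 * Real.pi) * (1 - stdNormalCDF t)) := by
  unfold millsRatio
  ring

open Filter Topology in
lemma mul_millsRatio_le_one (t : ℝ) : t * millsRatio t ≤ 1 := by
  rcases le_or_gt t 0 with ht | ht
  · nlinarith [millsRatio_nonneg t]
  let h : ℝ → ℝ := fun u =>
    u⁻¹ * Real.exp (-(u ^ 2 / 2)) - Real.sqrt (2 * Real.pi) * (1 - stdNormalCDF u)
  have hd : ∀ u, 0 < u → HasDerivAt h (-(Real.exp (-(u ^ 2 / 2)) / u ^ 2)) u := by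
    intro u hu
    refine (((hasDerivAt_inv hu.ne').mul (hasDerivAt_exp_neg_half_sq u)).sub
      (hasDerivAt_normal_tail u)).congr_deriv ?_
    field_simp
    ring
  have hanti : AntitoneOn h (Set.Ici t) := by
    refine antitoneOn_of_hasDerivWithinAt_nonpos (convex_Ici t)
      (f' := fun u => -(Real.exp (-(u ^ 2 / 2)) / u ^ 2)) ?_ ?_ ?_
    · exact fun u hu => (hd u (lt_of_lt_of_le ht hu)).continuousAt.continuousWithinAt
    · intro u hu
      rw [interior_Ici] at hu
      exact (hd u (ht.trans hu)).hasDerivWithinAt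
    · intro u _
      exact neg_nonpos.2 (by positivity)
  have hlim : Tendsto h atTop (𝓝 0) := by
    have := (tendsto_inv_atTop_zero.mul tendsto_exp_neg_half_sq).sub tendsto_normal_tail
    rwa [mul_zero, sub_zero] at this
  have hpos : 0 ≤ h t := by
    refine le_of_tendsto hlim ?_
    filter_upwards [eventually_ge_atTop t] with u hu
    exact hanti Set.self_mem_Ici hu hu
  have e : Real.exp (t ^ 2 / 2) * Real.exp (-(t ^ 2 / 2)) = 1 := by
    rw [← Real.exp_add]
    simp
  have h2 : 0 ≤ (t * Real.exp (t ^ 2 / 2)) * h t := mul_nonneg (by positivity) hpos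
  have h3 : (t * Real.exp (t ^ 2 / 2)) * h t = 1 - t * millsRatio t := by
    rw [millsRatio_eq]
    simp only [h]
    field_simp
    linear_combination e
  linarith

open Filter Topology in
lemma le_one_add_sq_mul_millsRatio (t : ℝ) : t ≤ (1 + t ^ 2) * millsRatio t := by
  let h : ℝ → ℝ := fun u =>
    Real.sqrt (2 * Real.pi) * (1 - stdNormalCDF u) - u / (1 + u ^ 2) * Real.exp (-(u ^ 2 / 2))
  have hd : ∀ u, HasDerivAt h (-(2 * Real.exp (-(u ^ 2 / 2)) / (1 + u ^ 2) ^ 2)) u := by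
    intro u
    have hne : 1 + u ^ 2 ≠ 0 := by positivity
    have hden : HasDerivAt (fun u : ℝ => 1 + u ^ 2) (2 * u) u := by
      simpa using (hasDerivAt_pow 2 u).const_add 1
    refine ((hasDerivAt_normal_tail u).sub
      (((hasDerivAt_id' u).fun_div hden hne).mul (hasDerivAt_exp_neg_half_sq u))).congr_deriv ?_
    field_simp
    ring
  have hanti : Antitone h :=
    antitone_of_hasDerivAt_nonpos hd fun u => neg_nonpos.2 (by positivity)
  have hlim : Tendsto h atTop (𝓝 0) := by
    have h0 : Tendsto (fun u : ℝ => u / (1 + u ^ 2) * Real.exp (-(u ^ 2 / 2))) atTop (𝓝 0) := by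
      refine squeeze_zero' ?_ ?_ tendsto_exp_neg_half_sq
      · filter_upwards [eventually_ge_atTop 0] with u hu
        positivity
      · refine Eventually.of_forall fun u => ?_
        refine mul_le_of_le_one_left (Real.exp_pos _).le ?_
        rw [div_le_one (by positivity)]
        nlinarith [sq_nonneg (u - 1)]
    have := tendsto_normal_tail.sub h0
    rwa [sub_zero] at this
  have hpos : 0 ≤ h t := hanti.le_of_tendsto hlim t
  have e : Real.exp (t ^ 2 / 2) * Real.exp (-(t ^ 2 / 2)) = 1 := by
    rw [← Real.exp_add]
    simp
  have h2 : 0 ≤ ((1 + t ^ 2) * Real.exp (t ^ 2 / 2)) * h t := mul_nonneg (by positivity) hpos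
  have h3 : ((1 + t ^ 2) * Real.exp (t ^ 2 / 2)) * h t = (1 + t ^ 2) * millsRatio t - t := by
    have hne : 1 + t ^ 2 ≠ 0 := by positivity
    rw [millsRatio_eq]
    simp only [h]
    field_simp
    linear_combination (-t) * e
  linarith

lemma millsRatio_antitone : Antitone millsRatio :=
  antitone_of_hasDerivAt_nonpos millsRatio_hasDerivAt fun t => by
    have := mul_millsRatio_le_one t
    simpa using this

lemma millsRatio_le_of_nonneg {t : ℝ} (ht : 0 ≤ t) : millsRatio t ≤ 1.26 := by
  refine (millsRatio_antitone ht).trans ?_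
  have hs : Real.sqrt (2 * Real.pi) ≤ 2.52 := by
    rw [Real.sqrt_le_left (by norm_num)]
    nlinarith [Real.pi_lt_d2]
  unfold millsRatio
  rw [stdNormalCDF_zero]
  norm_num at hs ⊢
  linarith

lemma one_le_sqrt_two_pi : 1 ≤ Real.sqrt (2 * Real.pi) := by
  rw [Real.one_le_sqrt]
  linarith [Real.pi_gt_three]

lemma one_add_sq_mul_millsRatio_sub_le {t : ℝ} (ht : 0 ≤ t) :
    (1 + t ^ 2) * millsRatio t - t ≤ 1.6 := by
  have h1 := millsRatio_le_of_nonneg ht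
  have h2 := mul_millsRatio_le_one t
  rcases le_or_gt t 0.625 with h | h
  · norm_num at *
    nlinarith
  · norm_num at *
    have h3 : millsRatio t ≤ 1.6 := by linarith
    nlinarith

lemma steinF_of_le {x w : ℝ} (h : w ≤ x) :
    steinF x w = millsRatio (-w) * (1 - stdNormalCDF x) := by
  rw [steinF, if_pos h, millsRatio_neg]

lemma steinF_of_lt {x w : ℝ} (h : x < w) :
    steinF x w = millsRatio w * stdNormalCDF x := by
  rw [steinF, if_neg h.not_ge, millsRatio]
  ring

lemma steinF'_of_le {x w : ℝ} (h : w ≤ x) :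
    steinF' x w = (w * millsRatio (-w) + 1) * (1 - stdNormalCDF x) := by
  rw [steinF', if_pos h, millsRatio_neg]
  ring

lemma steinF'_of_lt {x w : ℝ} (h : x < w) :
    steinF' x w = (w * millsRatio w - 1) * stdNormalCDF x := by
  rw [steinF', if_neg h.not_ge, millsRatio]
  ring

lemma steinG_of_le {x w : ℝ} (h : w ≤ x) :
    steinG x w = ((1 + w ^ 2) * millsRatio (-w) + w) * (1 - stdNormalCDF x) := by
  rw [steinG, steinF_of_le h, steinF'_of_le h]
  ring

lemma steinG_of_lt {x w : ℝ} (h : x < w) :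
    steinG x w = ((1 + w ^ 2) * millsRatio w - w) * stdNormalCDF x := by
  rw [steinG, steinF_of_lt h, steinF'_of_lt h]
  ring

lemma exp_half_le : Real.exp (1 / 2) ≤ 1.7 := by
  have h : Real.exp (1 / 2) ^ 2 = Real.exp 1 := by
    rw [← Real.exp_nat_mul]
    norm_num
  have := Real.exp_one_lt_d9
  refine (pow_le_pow_iff_left₀ (Real.exp_pos _).le (by norm_num) two_ne_zero).1 ?_
  rw [h]
  norm_num at *
  linarith

/-- Bound on the left branch at distance one from the jump, from the upper Mills inequality. -/
lemma mul_tail_shift_le (x : ℝ) :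
    x * (Real.sqrt (2 * Real.pi) * Real.exp ((x - 1) ^ 2 / 2) * (1 - stdNormalCDF x)) ≤
      Real.exp (1 / 2 - x) := by
  have e : Real.exp ((x - 1) ^ 2 / 2) = Real.exp (1 / 2 - x) * Real.exp (x ^ 2 / 2) := by
    rw [← Real.exp_add]
    ring_nf
  have h := mul_le_mul_of_nonneg_left (mul_millsRatio_le_one x) (Real.exp_pos (1 / 2 - x)).le
  rw [e]
  unfold millsRatio at h
  linarith

lemma mul_millsRatio_neg_add_one_nonneg (w : ℝ) : 0 ≤ w * millsRatio (-w) + 1 := by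
  linarith [mul_millsRatio_le_one (-w)]

lemma mul_millsRatio_neg_mono {v w : ℝ} (hv : 0 ≤ v) (h : v ≤ w) :
    v * millsRatio (-v) ≤ w * millsRatio (-w) :=
  mul_le_mul h (millsRatio_antitone (neg_le_neg h)) (millsRatio_nonneg _) (hv.trans h)

/-- At the jump both branches agree up to the factors `Φ` and `1 - Φ`. -/
lemma millsRatio_neg_mul_tail (x : ℝ) :
    millsRatio (-x) * (1 - stdNormalCDF x) = millsRatio x * stdNormalCDF x := by
  rw [millsRatio_neg, millsRatio]
  ring

/-- **Nonuniform bounds for the Stein solution when `x ≥ 1`.**  For `x ≥ 1`: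
`f_x(w) ≤ 1.7 e^{−x}` for `w ≤ x−1`, `f_x(w) ≤ 1/x` for `x−1 < w ≤ x`,
`f_x(w) ≤ 1/w` for `w > x`; `|f_x′(w)| ≤ e^{1/2−x}` for `w ≤ x−1`, `|f_x′(w)| ≤ 1` for
`x−1 < w ≤ x`, `|f_x′(w)| ≤ (1+x²)⁻¹` for `w > x`; `g_x(w) ≥ 0` everywhere,
`g_x(w) ≤ 1.6 (1−Φ(x))` for `w ≤ 0`, `g_x(w) ≤ 1/w` for `w > x`; `g_x` is increasing on
`[0,x]` with `g_x(x−1) ≤ x e^{1/2−x}` and `g_x(x) ≤ x+2`. -/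
theorem stein_solution_nonuniform_bounds (x : ℝ) (hx : 1 ≤ x) :
    (∀ w : ℝ, w ≤ x - 1 → steinF x w ≤ 1.7 * Real.exp (-x)) ∧
    (∀ w : ℝ, x - 1 < w → w ≤ x → steinF x w ≤ 1 / x) ∧
    (∀ w : ℝ, x < w → steinF x w ≤ 1 / w) ∧
    (∀ w : ℝ, w ≤ x - 1 → |steinF' x w| ≤ Real.exp (1 / 2 - x)) ∧
    (∀ w : ℝ, x - 1 < w → w ≤ x → |steinF' x w| ≤ 1) ∧
    (∀ w : ℝ, x < w → |steinF' x w| ≤ (1 + x ^ 2)⁻¹) ∧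
    (∀ w : ℝ, 0 ≤ steinG x w) ∧
    (∀ w : ℝ, w ≤ 0 → steinG x w ≤ 1.6 * (1 - stdNormalCDF x)) ∧
    (∀ w : ℝ, x < w → steinG x w ≤ 1 / w) ∧
    MonotoneOn (steinG x) (Set.Icc 0 x) ∧
    steinG x (x - 1) ≤ x * Real.exp (1 / 2 - x) ∧
    steinG x x ≤ x + 2 := by
  have hx0 : 0 < x := by linarith
  have hΦ0 := stdNormalCDF_nonneg x
  have hΦ1 := stdNormalCDF_le_one x
  have hq : 0 ≤ 1 - stdNormalCDF x := by linarith
  set S := Real.sqrt (2 * Real.pi) * Real.exp ((x - 1) ^ 2 / 2) * (1 - stdNormalCDF x) with hS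
  have hxS : x * S ≤ Real.exp (1 / 2 - x) := mul_tail_shift_le x
  have hqS : 1 - stdNormalCDF x ≤ S := by
    refine le_mul_of_one_le_left hq (one_le_mul_of_one_le_of_one_le one_le_sqrt_two_pi ?_)
    exact Real.one_le_exp (by positivity)
  have hS0 : 0 ≤ S := hq.trans hqS
  have hSx : S ≤ x * S := le_mul_of_one_le_left hS0 hx
  have hFS : millsRatio (-(x - 1)) * (1 - stdNormalCDF x) ≤ S := by
    have : millsRatio (-(x - 1)) * (1 - stdNormalCDF x) = S * stdNormalCDF (x - 1) := by
      rw [millsRatio_neg, hS]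
      ring
    rw [this]
    exact mul_le_of_le_one_right hS0 (stdNormalCDF_le_one _)
  have hRx := mul_millsRatio_le_one x
  have hjump := millsRatio_neg_mul_tail x
  have hxF : x * (millsRatio (-x) * (1 - stdNormalCDF x)) ≤ stdNormalCDF x := by
    rw [hjump, ← mul_assoc]
    exact mul_le_of_le_one_left hΦ0 hRx
  refine ⟨?_, ?_, ?_, ?_, ?_, ?_, ?_, ?_, ?_, ?_, ?_, ?_⟩
  · intro w hw
    rw [steinF_of_le (by linarith)]
    have h1 : millsRatio (-w) * (1 - stdNormalCDF x) ≤ S :=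
      (mul_le_mul_of_nonneg_right (millsRatio_antitone (neg_le_neg hw)) hq).trans hFS
    have h2 : Real.exp (1 / 2 - x) = Real.exp (1 / 2) * Real.exp (-x) := by
      rw [← Real.exp_add, sub_eq_add_neg]
    have h3 := mul_le_mul_of_nonneg_right exp_half_le (Real.exp_pos (-x)).le
    linarith
  · intro w _ hw
    rw [steinF_of_le hw, le_div_iff₀ hx0]
    have h1 := mul_le_mul_of_nonneg_right (millsRatio_antitone (neg_le_neg hw)) hq
    have h2 := mul_le_mul_of_nonneg_left h1 hx0.le
    linarith
  · intro w hw
    rw [steinF_of_lt hw, le_div_iff₀ (by linarith)]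
    have h1 := mul_le_mul_of_nonneg_right (mul_millsRatio_le_one w) hΦ0
    linarith
  · intro w hw
    rw [steinF'_of_le (by linarith),
      abs_of_nonneg (mul_nonneg (mul_millsRatio_neg_add_one_nonneg w) hq)]
    rcases le_or_gt w 0 with h | h
    · have h1 : w * millsRatio (-w) + 1 ≤ 1 := by
        linarith [mul_nonpos_of_nonpos_of_nonneg h (millsRatio_nonneg (-w))]
      have h2 := mul_le_of_le_one_left hq h1
      linarith
    · have h1 := mul_le_mul_of_nonneg_right (mul_millsRatio_neg_mono h.le hw) hq
      have h2 := mul_le_mul_of_nonneg_left hFS (by linarith : 0 ≤ x - 1)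
      linarith
  · intro w hw1 hw
    rw [steinF'_of_le hw, abs_of_nonneg (mul_nonneg (mul_millsRatio_neg_add_one_nonneg w) hq)]
    have h1 := mul_le_mul_of_nonneg_right
      (mul_millsRatio_neg_mono (by linarith : 0 ≤ w) hw) hq
    linarith
  · intro w hw
    have hR := mul_millsRatio_le_one w
    have h1 : 1 - w * millsRatio w ≤ (1 + w ^ 2)⁻¹ := by
      rw [← one_div, le_div_iff₀ (by positivity)]
      nlinarith [mul_le_mul_of_nonneg_left (le_one_add_sq_mul_millsRatio w)
        (by linarith : 0 ≤ w)]
    have h2 : (1 + w ^ 2)⁻¹ ≤ (1 + x ^ 2)⁻¹ :=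
      inv_anti₀ (by positivity) (by nlinarith)
    rw [steinF'_of_lt hw, abs_of_nonpos (mul_nonpos_of_nonpos_of_nonneg (by linarith) hΦ0)]
    have h3 := mul_le_of_le_one_right (by linarith : 0 ≤ 1 - w * millsRatio w) hΦ1
    linarith
  · intro w
    rcases le_or_gt w x with h | h
    · rw [steinG_of_le h]
      refine mul_nonneg ?_ hq
      have := le_one_add_sq_mul_millsRatio (-w)
      rw [neg_sq] at this
      linarith
    · rw [steinG_of_lt h]
      refine mul_nonneg ?_ hΦ0
      linarith [le_one_add_sq_mul_millsRatio w]
  · intro w hw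
    rw [steinG_of_le (by linarith)]
    refine mul_le_mul_of_nonneg_right ?_ hq
    have := one_add_sq_mul_millsRatio_sub_le (neg_nonneg.2 hw)
    rw [neg_sq] at this
    linarith
  · intro w hw
    have hw0 : 0 < w := hx0.trans hw
    rw [steinG_of_lt hw, le_div_iff₀ hw0]
    have h1 := mul_le_mul_of_nonneg_left (mul_millsRatio_le_one w)
      (by positivity : 0 ≤ 1 + w ^ 2)
    have h2 : ((1 + w ^ 2) * millsRatio w - w) * w ≤ 1 := by linarith
    calc ((1 + w ^ 2) * millsRatio w - w) * stdNormalCDF x * w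
        = (((1 + w ^ 2) * millsRatio w - w) * w) * stdNormalCDF x := by ring
      _ ≤ 1 * stdNormalCDF x := mul_le_mul_of_nonneg_right h2 hΦ0
      _ ≤ 1 := by linarith
  · intro v hv w hw hvw
    rw [steinG_of_le hv.2, steinG_of_le hw.2]
    refine mul_le_mul_of_nonneg_right (add_le_add ?_ hvw) hq
    refine mul_le_mul ?_ (millsRatio_antitone (neg_le_neg hvw)) (millsRatio_nonneg _)
      (by positivity)
    have := pow_le_pow_left₀ hv.1 hvw 2
    linarith
  · rw [steinG_of_le (by linarith)]
    have h1 := mul_le_mul_of_nonneg_left hFS (by positivity : 0 ≤ 1 + (x - 1) ^ 2)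
    have h2 := mul_le_mul_of_nonneg_left hqS (by linarith : 0 ≤ x - 1)
    have h3 := mul_le_mul_of_nonneg_left hxS hx0.le
    nlinarith [mul_nonneg hS0 (by linarith : 0 ≤ x - 1)]
  · rw [steinG_of_le le_rfl]
    have h1 := mul_le_mul_of_nonneg_left hxF hx0.le
    have h2 : millsRatio (-x) * (1 - stdNormalCDF x) ≤ 1 := by
      have : 0 ≤ millsRatio (-x) * (1 - stdNormalCDF x) :=
        mul_nonneg (millsRatio_nonneg _) hq
      nlinarith
    linarith

end
end

section
/- For n ≥ 2 and a_n(x) = ( n/(n + x² − 1) )^{1/2}, there exists an absolute constant C > 0 such that for all x ≥ 0: |Φ(x·a_n(x)) − Φ(x)| ≤ exp(−n/4) + (C/√n)·exp(−x²/8). -/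
open MeasureTheory ProbabilityTheory

noncomputable section

theorem stdNormalCDF_sub_eq_measureReal {a b : ℝ} (hab : a ≤ b) :
    stdNormalCDF b - stdNormalCDF a = (gaussianReal 0 1).real (Set.Ioc a b) := by
  have h := measureReal_sdiff (μ := gaussianReal 0 1) (Set.Iic_subset_Iic.mpr hab)
    measurableSet_Iic
  rw [show Set.Iic b \ Set.Iic a = Set.Ioc a b by ext; simp [and_comm]] at h
  exact h.symm

theorem stdNormalCDF_mono_s19 {a b : ℝ} (hab : a ≤ b) : stdNormalCDF a ≤ stdNormalCDF b := by
  rw [← sub_nonneg, stdNormalCDF_sub_eq_measureReal hab]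
  exact measureReal_nonneg

theorem gaussianPDFReal_zero_one_le_exp (x : ℝ) :
    gaussianPDFReal 0 1 x ≤ Real.exp (-(x ^ 2 / 2)) := by
  have h : (√(2 * Real.pi * (1 : NNReal)))⁻¹ ≤ 1 := by
    apply inv_le_one_of_one_le₀
    rw [Real.one_le_sqrt, NNReal.coe_one]
    linarith [Real.pi_gt_three]
  rw [gaussianPDFReal_def]
  refine (mul_le_of_le_one_left (Real.exp_pos _).le h).trans_eq ?_
  simp [neg_div]

/-- The increment of `Φ` on `[a, b]` is at most `exp (-a² / 2) * (b - a)` when `0 ≤ a`. -/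
theorem stdNormalCDF_sub_le_exp_mul {a b : ℝ} (ha : 0 ≤ a) (hab : a ≤ b) :
    stdNormalCDF b - stdNormalCDF a ≤ Real.exp (-(a ^ 2 / 2)) * (b - a) := by
  rw [stdNormalCDF_sub_eq_measureReal hab, measureReal_def]
  refine ENNReal.toReal_le_of_le_ofReal
    (mul_nonneg (Real.exp_pos _).le (sub_nonneg.mpr hab)) ?_
  rw [gaussianReal_apply 0 one_ne_zero, ENNReal.ofReal_mul (Real.exp_pos _).le,
    ← Real.volume_Ioc, ← setLIntegral_const]
  refine setLIntegral_mono measurable_const fun x hx => ENNReal.ofReal_le_ofReal ?_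
  refine (gaussianPDFReal_zero_one_le_exp x).trans ?_
  have := hx.1.le
  gcongr

/-- Chernoff bound for the increment of `Φ` to the right of `a`. -/
theorem stdNormalCDF_sub_le_exp {a b : ℝ} (ha : 0 ≤ a) (hab : a ≤ b) :
    stdNormalCDF b - stdNormalCDF a ≤ Real.exp (-(a ^ 2 / 2)) := by
  rw [stdNormalCDF_sub_eq_measureReal hab]
  have hsub : (gaussianReal 0 1).real (Set.Ioc a b) ≤ (gaussianReal 0 1).real {x | a ≤ id x} :=
    measureReal_mono fun x hx => hx.1.le
  refine hsub.trans ((measure_ge_le_exp_mul_mgf a ha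
    (integrable_exp_mul_gaussianReal a)).trans_eq ?_)
  rw [mgf_fun_id_gaussianReal, ← Real.exp_add]
  congr 1
  push_cast
  ring

theorem pow_three_le_exp (x : ℝ) : x ^ 3 ≤ 129 * Real.exp (x ^ 2 / 8) := by
  have h := Real.quadratic_le_exp_of_nonneg (show 0 ≤ x ^ 2 / 8 by positivity)
  nlinarith [sq_nonneg (x ^ 2 - x), sq_nonneg (x - 1), sq_nonneg x]

theorem one_div_le_one_div_sqrt {y : ℝ} (hy : 1 ≤ y) : 1 / y ≤ 1 / √y :=
  one_div_le_one_div_of_le (Real.sqrt_pos.mpr (by linarith))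
    ((Real.sqrt_le_left (by linarith)).mpr (by nlinarith))

theorem stdNormalCDF_bridging_of_lt_one {y x : ℝ} (hy : 2 ≤ y) (hx : 0 ≤ x) (hx1 : x < 1) :
    |stdNormalCDF (x * √(y / (y + x ^ 2 - 1))) - stdNormalCDF x| ≤
      200 / √y * Real.exp (-(x ^ 2 / 8)) := by
  have hx2 : x ^ 2 < 1 := by nlinarith
  have hd : 0 < y + x ^ 2 - 1 := by nlinarith
  set a := √(y / (y + x ^ 2 - 1)) with ha
  have ha2 : a ^ 2 = y / (y + x ^ 2 - 1) := Real.sq_sqrt (by positivity)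
  have ha1 : 1 ≤ a := Real.one_le_sqrt.mpr ((one_le_div hd).mpr (by linarith))
  have hxa : x ≤ x * a := le_mul_of_one_le_right hx ha1
  rw [abs_of_nonneg (sub_nonneg.mpr (stdNormalCDF_mono_s19 hxa))]
  have hgap : a ^ 2 - 1 ≤ 2 * (1 / y) := by
    have hle : y / (y + x ^ 2 - 1) ≤ 1 + 2 / y := by
      rw [div_le_iff₀ hd]
      have : (1 + 2 / y) * (y + x ^ 2 - 1) - y = 1 + x ^ 2 + 2 * (x ^ 2 - 1) / y := by
        field_simp
        ring
      have h2 : -1 ≤ 2 * (x ^ 2 - 1) / y := by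
        rw [le_div_iff₀ (by linarith)]
        nlinarith
      nlinarith
    rw [ha2, mul_one_div]
    linarith
  have hexp : 1 / 2 ≤ Real.exp (-(x ^ 2 / 8)) := by
    linarith [Real.add_one_le_exp (-(x ^ 2 / 8))]
  have hs : 0 < 1 / √y := one_div_pos.mpr (Real.sqrt_pos.mpr (by linarith))
  calc stdNormalCDF (x * a) - stdNormalCDF x
      ≤ Real.exp (-(x ^ 2 / 2)) * (x * a - x) := stdNormalCDF_sub_le_exp_mul hx hxa
    _ ≤ 1 * (x * a - x) := by
        refine mul_le_mul_of_nonneg_right (Real.exp_le_one_iff.mpr ?_) (by linarith)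
        linarith [sq_nonneg x]
    _ ≤ a ^ 2 - 1 := by nlinarith
    _ ≤ 2 * (1 / √y) := hgap.trans (by linarith [one_div_le_one_div_sqrt (y := y) (by linarith)])
    _ ≤ 200 / √y * Real.exp (-(x ^ 2 / 8)) := by
        rw [div_eq_mul_one_div 200]
        nlinarith

theorem stdNormalCDF_bridging_of_one_le {y x : ℝ} (hy : 2 ≤ y) (hx1 : 1 ≤ x) :
    |stdNormalCDF (x * √(y / (y + x ^ 2 - 1))) - stdNormalCDF x| ≤
      Real.exp (-(y / 4)) + 200 / √y * Real.exp (-(x ^ 2 / 8)) := by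
  have hx2 : 1 ≤ x ^ 2 := one_le_pow₀ hx1
  have hx : 0 ≤ x := by linarith
  have hd : 0 < y + x ^ 2 - 1 := by linarith
  set a := √(y / (y + x ^ 2 - 1)) with ha
  have ha2 : a ^ 2 = y / (y + x ^ 2 - 1) := Real.sq_sqrt (by positivity)
  have ha0 : 0 ≤ a := Real.sqrt_nonneg _
  have ha1 : a ≤ 1 := Real.sqrt_le_one.mpr ((div_le_one hd).mpr (by linarith))
  have hxa : x * a ≤ x := mul_le_of_le_one_right hx ha1
  have hxa0 : 0 ≤ x * a := mul_nonneg hx ha0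
  have hxa2 : (x * a) ^ 2 = x ^ 2 * y / (y + x ^ 2 - 1) := by
    rw [mul_pow, ha2, mul_div_assoc]
  rw [abs_sub_comm, abs_of_nonneg (sub_nonneg.mpr (stdNormalCDF_mono_s19 hxa))]
  rcases le_total y (x ^ 2) with hyx | hyx
  · have hlow : y / 2 ≤ (x * a) ^ 2 := by
      rw [hxa2, le_div_iff₀ hd]
      nlinarith
    have hnn : 0 ≤ 200 / √y * Real.exp (-(x ^ 2 / 8)) := by positivity
    have hmono : Real.exp (-((x * a) ^ 2 / 2)) ≤ Real.exp (-(y / 4)) :=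
      Real.exp_le_exp.mpr (by linarith)
    linarith [stdNormalCDF_sub_le_exp hxa0 hxa]
  · have hlow : x ^ 2 / 2 ≤ (x * a) ^ 2 := by
      rw [hxa2, le_div_iff₀ hd]
      nlinarith
    have hgap : 1 - a ≤ x ^ 2 * (1 / y) := by
      have hle : 1 - x ^ 2 * (1 / y) ≤ a ^ 2 := by
        rw [ha2, le_div_iff₀ hd]
        have : (1 - x ^ 2 * (1 / y)) * (y + x ^ 2 - 1) = y - 1 - x ^ 2 * (x ^ 2 - 1) / y := by
          field_simp
          ring
        have h2 : 0 ≤ x ^ 2 * (x ^ 2 - 1) / y :=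
          div_nonneg (mul_nonneg (by positivity) (by linarith)) (by linarith)
        linarith
      nlinarith
    have hsplit : Real.exp (-(x ^ 2 / 4)) * Real.exp (x ^ 2 / 8) = Real.exp (-(x ^ 2 / 8)) := by
      rw [← Real.exp_add]
      congr 1
      ring
    have hmain : stdNormalCDF x - stdNormalCDF (x * a) ≤ 200 / √y * Real.exp (-(x ^ 2 / 8)) := by
      calc stdNormalCDF x - stdNormalCDF (x * a)
          ≤ Real.exp (-((x * a) ^ 2 / 2)) * (x - x * a) := stdNormalCDF_sub_le_exp_mul hxa0 hxa
        _ ≤ Real.exp (-(x ^ 2 / 4)) * (x - x * a) := by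
            refine mul_le_mul_of_nonneg_right (Real.exp_le_exp.mpr ?_) (by linarith)
            linarith
        _ ≤ Real.exp (-(x ^ 2 / 4)) * (x ^ 3 * (1 / √y)) := by
            gcongr
            calc x - x * a = x * (1 - a) := by ring
              _ ≤ x * (x ^ 2 * (1 / y)) := by gcongr
              _ = x ^ 3 * (1 / y) := by ring
              _ ≤ x ^ 3 * (1 / √y) := by
                  gcongr ?_ * ?_
                  exact one_div_le_one_div_sqrt (by linarith)
        _ ≤ Real.exp (-(x ^ 2 / 4)) * (200 * Real.exp (x ^ 2 / 8) * (1 / √y)) := by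
            gcongr
            linarith [pow_three_le_exp x, Real.exp_pos (x ^ 2 / 8)]
        _ = 200 / √y * Real.exp (-(x ^ 2 / 8)) := by
            rw [← hsplit]
            ring
    linarith [Real.exp_pos (-(y / 4))]

/-- **Bridging bound for the normal CDF.**  For `n ≥ 2` and
`a_n(x) = (n/(n + x² − 1))^{1/2}`, there is an absolute constant `C > 0` such that for
all `x ≥ 0`:
`|Φ(x a_n(x)) − Φ(x)| ≤ exp(−n/4) + (C/√n) exp(−x²/8)`. -/
theorem normalCDF_bridging_bound :
    ∃ C : ℝ, 0 < C ∧
      ∀ n : ℕ, 2 ≤ n → ∀ x : ℝ, 0 ≤ x →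
        |stdNormalCDF (x * Real.sqrt ((n : ℝ) / ((n : ℝ) + x ^ 2 - 1))) -
            stdNormalCDF x| ≤
          Real.exp (-((n : ℝ) / 4)) + C / Real.sqrt n * Real.exp (-(x ^ 2 / 8)) := by
  refine ⟨200, by norm_num, fun n hn x hx => ?_⟩
  have hy : (2 : ℝ) ≤ n := by exact_mod_cast hn
  rcases lt_or_ge x 1 with hx1 | hx1
  · linarith [stdNormalCDF_bridging_of_lt_one hy hx hx1, Real.exp_pos (-((n : ℝ) / 4))]
  · exact stdNormalCDF_bridging_of_one_le hy hx1

end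
end
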